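/- Let d ≥ 2 be an integer, θ > 0, and β, κ real numbers. Let u : ℝ^d → ℝ be a smooth, positive, ℤ^d-periodic function. Define Q u := L u − (1/θ)·((d−1)/(d+2))·(κ+β−1)·[ (∇u⊗∇u)/u − (|∇u|²/(d·u))·Id ], where L u := Hess u − (Δu/d)·Id. Then ∫_{[0,1]^d} [ θ(Δu)² + (κ+β−1)·Δu·|∇u|²/u + κ(β−1)·|∇u|⁴/u² ] dx = (θd/(d−1))·∫_{[0,1]^d} ‖Q u‖² dx − μ·∫_{[0,1]^d} |∇u|⁴/u² dx, where μ = (1/θ)·((d−1)/(d+2))²·(κ+β−1)² − κ(β−1) − (κ+β−1)·d/(d+2) and ‖A‖² = Σ_{i,j} A_{ij}². -/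

import Mathlib

open MeasureTheory

/-- The i-th partial derivative of f : ℝ^d → ℝ. -/
noncomputable def pd {d : ℕ} (i : Fin d) (f : (Fin d → ℝ) → ℝ) (x : Fin d → ℝ) : ℝ :=
  fderiv ℝ f x (Pi.single i 1)

/-- The Laplacian of f : ℝ^d → ℝ. -/
noncomputable def lap {d : ℕ} (f : (Fin d → ℝ) → ℝ) (x : Fin d → ℝ) : ℝ :=
  ∑ i, pd i (pd i f) x

/-- The (i,j) entry of the trace-free Hessian L u = Hess u − (Δu/d)·Id. -/
noncomputable def traceFreeHess {d : ℕ} (u : (Fin d → ℝ) → ℝ) (i j : Fin d)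
    (x : Fin d → ℝ) : ℝ :=
  pd i (pd j u) x - (if i = j then lap u x / d else 0)

/-- The (i,j) entry of
Q u = L u − (1/θ)((d−1)/(d+2))(κ+β−1)[(∇u⊗∇u)/u − (|∇u|²/(d·u))·Id]. -/
noncomputable def Qmat {d : ℕ} (θ β κ : ℝ) (u : (Fin d → ℝ) → ℝ) (i j : Fin d)
    (x : Fin d → ℝ) : ℝ :=
  traceFreeHess u i j x
    - (1 / θ) * (((d : ℝ) - 1) / ((d : ℝ) + 2)) * (κ + β - 1) *
      (pd i u x * pd j u x / u x
        - (if i = j then (∑ k, (pd k u x) ^ 2) / ((d : ℝ) * u x) else 0))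

section PartialDerivatives

variable {d : ℕ} {f g : (Fin d → ℝ) → ℝ}

lemma ContDiff.pd (hf : ContDiff ℝ (⊤ : ℕ∞) f) (i : Fin d) :
    ContDiff ℝ (⊤ : ℕ∞) (pd i f) := by
  have h : ContDiff ℝ (⊤ : ℕ∞) (fderiv ℝ f) := hf.fderiv_right (by simp)
  exact h.clm_apply contDiff_const

lemma ContDiff.differentiableAt_of_smooth (hf : ContDiff ℝ (⊤ : ℕ∞) f) (x : Fin d → ℝ) :
    DifferentiableAt ℝ f x :=
  (hf.differentiable (by simp)) x

lemma pd_add_right (i : Fin d) (f : (Fin d → ℝ) → ℝ) {v : Fin d → ℝ}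
    (h : ∀ x, f (x + v) = f x) (x : Fin d → ℝ) : pd i f (x + v) = pd i f x := by
  unfold pd
  rw [← fderiv_comp_add_right v]
  simp only [h]

lemma pd_comm (hf : ContDiff ℝ (⊤ : ℕ∞) f) (i j : Fin d) : pd i (pd j f) = pd j (pd i f) := by
  funext x
  have hs : IsSymmSndFDerivAt ℝ f x :=
    hf.contDiffAt.isSymmSndFDerivAt (by
      rw [minSmoothness_of_isRCLikeNormedField]
      exact WithTop.coe_le_coe.2 le_top)
  have hd : DifferentiableAt ℝ (fderiv ℝ f) x :=
    ((hf.fderiv_right (m := (⊤ : ℕ∞)) (by simp)).differentiable (by simp)) x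
  have key (k l : Fin d) : pd k (pd l f) x
      = fderiv ℝ (fderiv ℝ f) x (Pi.single k 1) (Pi.single l 1) := by
    change fderiv ℝ (fun y => fderiv ℝ f y (Pi.single l 1)) x (Pi.single k 1) = _
    rw [fderiv_clm_apply hd (differentiableAt_const _)]
    simp
  rw [key, key, hs.eq]

lemma pd_mul (i : Fin d) {x : Fin d → ℝ} (hf : DifferentiableAt ℝ f x)
    (hg : DifferentiableAt ℝ g x) :
    pd i (fun y => f y * g y) x = pd i f x * g x + f x * pd i g x := by
  unfold pd
  rw [fderiv_fun_mul hf hg]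
  simp
  ring

lemma pd_sub (i : Fin d) {x : Fin d → ℝ} (hf : DifferentiableAt ℝ f x)
    (hg : DifferentiableAt ℝ g x) :
    pd i (fun y => f y - g y) x = pd i f x - pd i g x := by
  unfold pd
  rw [fderiv_fun_sub hf hg]
  simp

lemma pd_sum {ι : Type*} (s : Finset ι) {F : ι → (Fin d → ℝ) → ℝ} (i : Fin d) {x : Fin d → ℝ}
    (hF : ∀ j ∈ s, DifferentiableAt ℝ (F j) x) :
    pd i (fun y => ∑ j ∈ s, F j y) x = ∑ j ∈ s, pd i (F j) x := by
  unfold pd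
  rw [fderiv_fun_sum hF]
  simp

lemma pd_div (i : Fin d) {x : Fin d → ℝ} (hf : DifferentiableAt ℝ f x)
    (hg : DifferentiableAt ℝ g x) (h0 : ∀ y, g y ≠ 0) :
    pd i (fun y => f y / g y) x = pd i f x / g x - f x * pd i g x / g x ^ 2 := by
  have hfg : DifferentiableAt ℝ (fun y => f y / g y) x := by
    simpa only [div_eq_mul_inv] using hf.fun_mul (hg.fun_inv (h0 x))
  have h := pd_mul i hfg hg
  simp only [div_mul_cancel₀ _ (h0 _)] at h
  have := h0 x
  change pd i f x = _ at h
  rw [h]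
  field_simp
  ring

end PartialDerivatives

lemma integral_sum_pd_eq_zero {d : ℕ} (F : Fin d → (Fin d → ℝ) → ℝ)
    (hF : ∀ i, ContDiff ℝ (⊤ : ℕ∞) (F i))
    (hper : ∀ i x, F i (x + Pi.single i 1) = F i x) :
    ∫ x in Set.Icc (0 : Fin d → ℝ) 1, ∑ i, pd i (F i) x = 0 := by
  obtain _ | n := d
  · simp
  have hcont : Continuous fun x => ∑ i, pd i (F i) x :=
    continuous_finsetSum _ fun i _ => ((hF i).pd i).continuous
  have h := integral_divergence_of_hasFDerivAt_off_countable' (0 : Fin (n + 1) → ℝ) 1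
    (fun i => zero_le_one) F (fun i x => fderiv ℝ (F i) x) ∅ Set.countable_empty
    (fun i => (hF i).continuous.continuousOn)
    (fun x _ i => ((hF i).differentiableAt_of_smooth x).hasFDerivAt)
    (hcont.continuousOn.integrableOn_compact isCompact_Icc)
  refine h.trans (Finset.sum_eq_zero fun i _ => sub_eq_zero.2 ?_)
  congr 1
  funext x
  rw [← hper i (Fin.insertNth i ((0 : Fin (n + 1) → ℝ) i) x)]
  congr 1
  funext j
  refine Fin.succAboveCases i ?_ (fun k => ?_) j
  · simp
  · simp

lemma sum_sq_sub_diagonal {d : ℕ} (hd : (d : ℝ) ≠ 0) (H : Fin d → Fin d → ℝ) (g : Fin d → ℝ)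
    (c v : ℝ) (hv : v ≠ 0) :
    ∑ i, ∑ j, (H i j - (if i = j then (∑ k, H k k) / d else 0)
        - c * (g i * g j / v - (if i = j then (∑ k, g k ^ 2) / (d * v) else 0))) ^ 2
      = ∑ i, ∑ j, H i j ^ 2 - (∑ k, H k k) ^ 2 / d
        - 2 * c * ((∑ i, ∑ j, H i j * g i * g j) / v - (∑ k, H k k) * (∑ k, g k ^ 2) / (d * v))
        + c ^ 2 * ((d - 1) / d) * ((∑ k, g k ^ 2) ^ 2 / v ^ 2) := by
  set D := ∑ k, H k k with hD
  set G := ∑ k, g k ^ 2 with hG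
  have hterm (i j : Fin d) : (H i j - (if i = j then D / d else 0)
        - c * (g i * g j / v - (if i = j then G / (d * v) else 0))) ^ 2
      = H i j ^ 2 - 2 * c / v * (H i j * g i * g j) + c ^ 2 / v ^ 2 * (g i ^ 2 * g j ^ 2)
        + (if i = j then (D / d - c * (G / (d * v))) ^ 2
          - 2 * (D / d - c * (G / (d * v))) * (H i i - c / v * g i ^ 2) else 0) := by
    split_ifs with hij
    · subst hij
      ring
    · ring
  simp only [hterm, Finset.sum_add_distrib, Finset.sum_sub_distrib, ← Finset.mul_sum,
    Finset.sum_ite_eq, Finset.mem_univ, if_true, Finset.sum_const, Finset.card_univ,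
    Fintype.card_fin, nsmul_eq_mul]
  rw [← hD, ← hG, ← Finset.sum_mul, ← hG]
  field_simp
  ring

section Smooth

variable {d : ℕ} {u : (Fin d → ℝ) → ℝ}

lemma sum_pd_hess_mul_grad_sub (hu : ContDiff ℝ (⊤ : ℕ∞) u) (x : Fin d → ℝ) :
    ∑ i, pd i (fun y => ∑ j, (pd i (pd j u) y * pd j u y - pd j (pd j u) y * pd i u y)) x
      = ∑ i, ∑ j, pd i (pd j u) x ^ 2 - lap u x ^ 2 := by
  have h1 (i : Fin d) := (hu.pd i).differentiableAt_of_smooth x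
  have h2 (i j : Fin d) := ((hu.pd j).pd i).differentiableAt_of_smooth x
  have hterm (i : Fin d) :
      pd i (fun y => ∑ j, (pd i (pd j u) y * pd j u y - pd j (pd j u) y * pd i u y)) x
      = ∑ j, (pd i (pd i (pd j u)) x * pd j u x - pd i (pd j (pd j u)) x * pd i u x
        + pd i (pd j u) x ^ 2 - pd j (pd j u) x * pd i (pd i u) x) := by
    rw [pd_sum _ _ fun j _ => ((h2 i j).fun_mul (h1 j)).fun_sub ((h2 j j).fun_mul (h1 i))]
    refine Finset.sum_congr rfl fun j _ => ?_
    rw [pd_sub i ((h2 i j).fun_mul (h1 j)) ((h2 j j).fun_mul (h1 i)), pd_mul i (h2 i j) (h1 j),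
      pd_mul i (h2 j j) (h1 i)]
    ring
  have hthird : ∑ i, ∑ j, pd i (pd i (pd j u)) x * pd j u x
      = ∑ i, ∑ j, pd i (pd j (pd j u)) x * pd i u x := by
    rw [Finset.sum_comm]
    refine Finset.sum_congr rfl fun i _ => Finset.sum_congr rfl fun j _ => ?_
    rw [pd_comm hu j i, pd_comm (hu.pd j) j i]
  have hlap : ∑ i, ∑ j, pd j (pd j u) x * pd i (pd i u) x = lap u x ^ 2 := by
    rw [sq, lap, Finset.sum_mul_sum]
    exact Finset.sum_comm
  rw [Finset.sum_congr rfl fun i _ => hterm i]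
  simp only [Finset.sum_add_distrib, Finset.sum_sub_distrib]
  rw [hthird, hlap]
  ring

lemma sum_pd_grad_mul_normSq_div (hu : ContDiff ℝ (⊤ : ℕ∞) u) (h0 : ∀ x, u x ≠ 0)
    (x : Fin d → ℝ) :
    ∑ i, pd i (fun y => pd i u y * (∑ j, pd j u y ^ 2) / u y) x
      = lap u x * (∑ j, pd j u x ^ 2) / u x
        + 2 * ((∑ i, ∑ j, pd i (pd j u) x * pd i u x * pd j u x) / u x)
        - (∑ j, pd j u x ^ 2) ^ 2 / u x ^ 2 := by
  have h1 (i : Fin d) := (hu.pd i).differentiableAt_of_smooth x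
  have hsq (j : Fin d) : DifferentiableAt ℝ (fun y => pd j u y ^ 2) x := (h1 j).fun_pow 2
  have hG : DifferentiableAt ℝ (fun y => ∑ j, pd j u y ^ 2) x :=
    DifferentiableAt.fun_sum fun j _ => hsq j
  have hterm (i : Fin d) : pd i (fun y => pd i u y * (∑ j, pd j u y ^ 2) / u y) x
      = pd i (pd i u) x * ((∑ j, pd j u x ^ 2) / u x)
        + 2 / u x * (∑ j, pd i (pd j u) x * pd i u x * pd j u x)
        - pd i u x ^ 2 * ((∑ j, pd j u x ^ 2) / u x ^ 2) := by
    have hpdG : pd i (fun y => ∑ j, pd j u y ^ 2) x = ∑ j, 2 * (pd i (pd j u) x * pd j u x) := by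
      rw [pd_sum _ _ fun j _ => hsq j]
      refine Finset.sum_congr rfl fun j _ => ?_
      simp only [sq]
      rw [pd_mul i (h1 j) (h1 j)]
      ring
    have hmove : ∑ j, pd i (pd j u) x * pd i u x * pd j u x
        = pd i u x * ∑ j, pd i (pd j u) x * pd j u x := by
      rw [Finset.mul_sum]
      exact Finset.sum_congr rfl fun j _ => by ring
    rw [pd_div i ((h1 i).fun_mul hG) (hu.differentiableAt_of_smooth x) h0, pd_mul i (h1 i) hG,
      hpdG, hmove, ← Finset.mul_sum]
    ring
  simp only [hterm, Finset.sum_add_distrib, Finset.sum_sub_distrib, ← Finset.sum_mul,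
    ← Finset.mul_sum]
  rw [lap]
  ring

end Smooth

/-- Completion-of-the-square identity of the flow method on the flat torus. -/
theorem completion_of_square (d : ℕ) (hd : 2 ≤ d) (θ β κ : ℝ) (hθ : 0 < θ)
    (u : (Fin d → ℝ) → ℝ) (hu : ContDiff ℝ (⊤ : ℕ∞) u) (hpos : ∀ x, 0 < u x)
    (hper : ∀ (x : Fin d → ℝ) (k : Fin d → ℤ), u (x + fun i => (k i : ℝ)) = u x) :
    ∫ x in Set.Icc (0 : Fin d → ℝ) 1,
        (θ * (lap u x) ^ 2
          + (κ + β - 1) * lap u x * (∑ i, (pd i u x) ^ 2) / u x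
          + κ * (β - 1) * (∑ i, (pd i u x) ^ 2) ^ 2 / (u x) ^ 2)
      = (θ * (d : ℝ) / ((d : ℝ) - 1)) *
          (∫ x in Set.Icc (0 : Fin d → ℝ) 1, ∑ i, ∑ j, (Qmat θ β κ u i j x) ^ 2)
        - ((1 / θ) * (((d : ℝ) - 1) / ((d : ℝ) + 2)) ^ 2 * (κ + β - 1) ^ 2
            - κ * (β - 1) - (κ + β - 1) * (d : ℝ) / ((d : ℝ) + 2)) *
          ∫ x in Set.Icc (0 : Fin d → ℝ) 1,
            (∑ i, (pd i u x) ^ 2) ^ 2 / (u x) ^ 2 := by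
  have hd0 : (d : ℝ) ≠ 0 := by positivity
  have hd1 : (d : ℝ) - 1 ≠ 0 := by
    have : (2 : ℝ) ≤ d := by exact_mod_cast hd
    linarith
  have hd2 : (d : ℝ) + 2 ≠ 0 := by positivity
  have h0 (x : Fin d → ℝ) : u x ≠ 0 := (hpos x).ne'
  have hshift (i : Fin d) (x : Fin d → ℝ) : u (x + Pi.single i 1) = u x := by
    rw [← hper x (Pi.single i 1)]
    congr 2
    funext j
    by_cases hij : j = i
    · subst hij; simp
    · simp [hij]
  have hpd (i j : Fin d) := pd_add_right j u (hshift i)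
  have hpd2 (i j k : Fin d) := pd_add_right j (pd k u) (hpd i k)
  have hc0 := hu.continuous
  have hc1 (i : Fin d) : Continuous (pd i u) := (hu.pd i).continuous
  have hc2 (i j : Fin d) : Continuous (pd i (pd j u)) := ((hu.pd j).pd i).continuous
  have hcl : Continuous (lap u) := by unfold lap; fun_prop
  have hI {f : (Fin d → ℝ) → ℝ} (hf : Continuous f) :
      Integrable f (volume.restrict (Set.Icc (0 : Fin d → ℝ) 1)) :=
    hf.continuousOn.integrableOn_compact isCompact_Icc
  have hBochner : ∫ x in Set.Icc (0 : Fin d → ℝ) 1,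
      (∑ i, ∑ j, pd i (pd j u) x ^ 2 - lap u x ^ 2) = 0 := by
    simp only [← sum_pd_hess_mul_grad_sub hu]
    refine integral_sum_pd_eq_zero _ (fun i => ?_) (fun i x => by simp only [hpd, hpd2])
    exact ContDiff.sum fun j _ => (((hu.pd j).pd i).mul (hu.pd j)).sub
      (((hu.pd j).pd j).mul (hu.pd i))
  have hGrad : ∫ x in Set.Icc (0 : Fin d → ℝ) 1,
      (lap u x * (∑ j, pd j u x ^ 2) / u x
        + 2 * ((∑ i, ∑ j, pd i (pd j u) x * pd i u x * pd j u x) / u x)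
        - (∑ j, pd j u x ^ 2) ^ 2 / u x ^ 2) = 0 := by
    simp only [← sum_pd_grad_mul_normSq_div hu h0]
    refine integral_sum_pd_eq_zero _ (fun i => ?_) (fun i x => by simp only [hpd, hshift])
    exact ((hu.pd i).mul (ContDiff.sum fun j _ => (hu.pd j).pow 2)).div hu h0
  have hQ (x : Fin d → ℝ) := sum_sq_sub_diagonal hd0 (fun i j => pd i (pd j u) x)
    (fun i => pd i u x) ((1 / θ) * (((d : ℝ) - 1) / ((d : ℝ) + 2)) * (κ + β - 1)) (u x) (h0 x)
  have hQint : Continuous fun x => ∑ i, ∑ j, Qmat θ β κ u i j x ^ 2 := by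
    have hif (i j : Fin d) {f : (Fin d → ℝ) → ℝ} (hf : Continuous f) :
        Continuous fun x => if i = j then f x else 0 := by
      split_ifs
      exacts [hf, continuous_const]
    have hdu (x : Fin d → ℝ) : (d : ℝ) * u x ≠ 0 := mul_ne_zero hd0 (h0 x)
    have hA (i j : Fin d) := hif i j (hcl.div_const d)
    have hB (i j : Fin d) := hif i j
      ((show Continuous fun x => ∑ k, pd k u x ^ 2 by fun_prop).div
        (continuous_const.mul hc0) hdu)
    have hC (i j : Fin d) := ((hc1 i).mul (hc1 j)).div hc0 h0
    unfold Qmat traceFreeHess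
    exact continuous_finsetSum _ fun i _ => continuous_finsetSum _ fun j _ =>
      (((hc2 i j).sub (hA i j)).sub (continuous_const.mul ((hC i j).sub (hB i j)))).pow 2
  have hWint : Continuous fun x => (∑ i, pd i u x ^ 2) ^ 2 / u x ^ 2 :=
    Continuous.div (by fun_prop) (by fun_prop) fun x => pow_ne_zero 2 (h0 x)
  have hBint : Continuous fun x => ∑ i, ∑ j, pd i (pd j u) x ^ 2 - lap u x ^ 2 := by fun_prop
  have hGint : Continuous fun x => lap u x * (∑ j, pd j u x ^ 2) / u x
        + 2 * ((∑ i, ∑ j, pd i (pd j u) x * pd i u x * pd j u x) / u x)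
        - (∑ j, pd j u x ^ 2) ^ 2 / u x ^ 2 := by
    refine ((Continuous.div (by fun_prop) hc0 h0).add
      (continuous_const.mul (Continuous.div (by fun_prop) hc0 h0))).sub hWint
  set C : ℝ := θ * (d : ℝ) / ((d : ℝ) - 1) with hC
  set μ : ℝ := (1 / θ) * (((d : ℝ) - 1) / ((d : ℝ) + 2)) ^ 2 * (κ + β - 1) ^ 2
            - κ * (β - 1) - (κ + β - 1) * (d : ℝ) / ((d : ℝ) + 2) with hμ
  have hpoint (x : Fin d → ℝ) : θ * (lap u x) ^ 2
          + (κ + β - 1) * lap u x * (∑ i, (pd i u x) ^ 2) / u x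
          + κ * (β - 1) * (∑ i, (pd i u x) ^ 2) ^ 2 / (u x) ^ 2
      = C * (∑ i, ∑ j, (Qmat θ β κ u i j x) ^ 2)
        - μ * ((∑ i, (pd i u x) ^ 2) ^ 2 / (u x) ^ 2)
        - C * (∑ i, ∑ j, pd i (pd j u) x ^ 2 - lap u x ^ 2)
        + (κ + β - 1) * d / (d + 2) * (lap u x * (∑ j, pd j u x ^ 2) / u x
          + 2 * ((∑ i, ∑ j, pd i (pd j u) x * pd i u x * pd j u x) / u x)
          - (∑ j, pd j u x ^ 2) ^ 2 / u x ^ 2) := by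
    have hx := h0 x
    have hQx : ∑ i, ∑ j, (Qmat θ β κ u i j x) ^ 2 = _ := hQ x
    have hl : ∑ k, pd k (pd k u) x = lap u x := rfl
    rw [hQx, hl, hC, hμ]
    generalize ∑ i, ∑ j, pd i (pd j u) x ^ 2 = S
    generalize ∑ i, ∑ j, pd i (pd j u) x * pd i u x * pd j u x = T
    generalize ∑ i, pd i u x ^ 2 = G
    generalize lap u x = D
    generalize u x = v at hx
    field_simp
    ring
  simp only [hpoint]
  have hCQ := continuous_const (y := C).fun_mul hQint
  have hμW := continuous_const (y := μ).fun_mul hWint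
  have hCB := continuous_const (y := C).fun_mul hBint
  rw [integral_add (hI ((hCQ.fun_sub hμW).fun_sub hCB)) (hI (continuous_const.fun_mul hGint)),
    integral_sub (hI (hCQ.fun_sub hμW)) (hI hCB),
    integral_sub (hI hCQ) (hI hμW)]
  simp only [integral_const_mul]
  rw [hBochner, hGrad]
  ring
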